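/- arXiv:2406.02493 — 2 statements merged into one kernel-verified Lean document; each statement's English description precedes it below -/
import Mathlib

section
/- Let F = F̆(α_1,…,α_t) be a fence, let i ∈ {1,…,t} with α_i ≥ 2, let x be an unshared element of the segment S_i, let v be the valley of S_i (if it exists) and p the peak of S_i (if it exists), and set y = s_{(i,1)} and z = s_{(i,β_i)}. Then, as functions on J(F): α_i·χ_x + χ_v + χ_p = 1 − T_v − Σ_{u : y ⊴ u ⊴ x} #[y,u]·T_u + Σ_{u : x ◁ u ⊴ z} #[u,z]·T_u, where the sums range over elements u of F in the indicated order intervals and #[a,b] denotes the number of elements r of F with a ⊴ r ⊴ b. -/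
open scoped Classical

namespace Fence

/-- partial sums: `m α i = α 0 + ⋯ + α (i-1)` (the paper's `m_i`). -/
def m (α : ℕ → ℕ) (i : ℕ) : ℕ := ∑ k ∈ Finset.range i, α k

/-- the number `n` of elements of the fence `F̆(α)`. -/
def nn (t : ℕ) (α : ℕ → ℕ) : ℕ := m α t - 1

/-- vertex type: index `0` is a dummy (used as sentinel for nonexistent elements);
the fence elements are the indices `1,…,nn t α`. -/
abbrev V (t : ℕ) (α : ℕ → ℕ) := Fin (nn t α + 1)

/-- the element `x_j` (1-based). -/
def xel (t : ℕ) (α : ℕ → ℕ) (j : ℕ) : V t α :=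
  ⟨j % (nn t α + 1), Nat.mod_lt _ (Nat.succ_pos _)⟩

/-- `p` is an actual element of the fence (not the dummy `0`). -/
def Elem (t : ℕ) (α : ℕ → ℕ) (p : V t α) : Prop := 1 ≤ (p : ℕ)

/-- the conditions on `(t, α)` for `F̆(α)` to be a fence. -/
def IsFence (t : ℕ) (α : ℕ → ℕ) : Prop :=
  2 ≤ t ∧ (∀ i < t, 1 ≤ α i) ∧ 2 ≤ α 0 ∧ 2 ≤ α (t - 1)

/-- the covering relation of the fence: `Cov t α a b` means `a ⋖ b`. -/
def Cov (t : ℕ) (α : ℕ → ℕ) (a b : V t α) : Prop :=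
  ∃ i < t, ((i % 2 = 0 ∧ (b : ℕ) = (a : ℕ) + 1) ∨ (i % 2 = 1 ∧ (a : ℕ) = (b : ℕ) + 1)) ∧
    m α i ≤ min (a : ℕ) (b : ℕ) ∧ min (a : ℕ) (b : ℕ) < m α (i + 1) ∧
    1 ≤ min (a : ℕ) (b : ℕ) ∧ max (a : ℕ) (b : ℕ) ≤ nn t α

/-- the order of the fence: reflexive–transitive closure of the covering relation. -/
def Le (t : ℕ) (α : ℕ → ℕ) : V t α → V t α → Prop := Relation.ReflTransGen (Cov t α)

/-- order ideals of the fence (as sets of actual elements, downward closed). -/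
def IsIdeal (t : ℕ) (α : ℕ → ℕ) (I : Set (V t α)) : Prop :=
  (∀ p ∈ I, Elem t α p) ∧ ∀ a b : V t α, Le t α a b → b ∈ I → a ∈ I

/-- `J t α` is the set of order ideals of the fence. -/
abbrev J (t : ℕ) (α : ℕ → ℕ) := {I : Set (V t α) // IsIdeal t α I}

/-- `p` is a maximal element of the set `I`. -/
def MaxIn (t : ℕ) (α : ℕ → ℕ) (I : Set (V t α)) (p : V t α) : Prop :=
  p ∈ I ∧ ∀ q ∈ I, Le t α p q → q = p

/-- `p` is a minimal element of the complement of `I` (among actual elements). -/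
def MinOut (t : ℕ) (α : ℕ → ℕ) (I : Set (V t α)) (p : V t α) : Prop :=
  Elem t α p ∧ p ∉ I ∧ ∀ q : V t α, Elem t α q → q ∉ I → Le t α q p → q = p

/-- the order-ideal indicator function `χ̂_p`. -/
noncomputable def chiHat (t : ℕ) (α : ℕ → ℕ) (p : V t α) (I : J t α) : ℝ :=
  if p ∈ I.1 then 1 else 0

/-- the antichain indicator function `χ_p`. -/
noncomputable def chi (t : ℕ) (α : ℕ → ℕ) (p : V t α) (I : J t α) : ℝ :=
  if MaxIn t α I.1 p then 1 else 0

/-- the toggleability statistic `T_p`. -/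
noncomputable def Tg (t : ℕ) (α : ℕ → ℕ) (p : V t α) (I : J t α) : ℝ :=
  if MinOut t α I.1 p then 1 else if MaxIn t α I.1 p then -1 else 0

/-- the antichain toggleability statistic `T_A`. -/
noncomputable def TA (t : ℕ) (α : ℕ → ℕ) (A : Set (V t α)) (I : J t α) : ℝ :=
  if ∀ p ∈ A, MinOut t α I.1 p then 1 else if ∀ p ∈ A, MaxIn t α I.1 p then -1 else 0

/-- `#[a,b]`: the number of elements `r` with `a ⊴ r ⊴ b`. -/
noncomputable def icard (t : ℕ) (α : ℕ → ℕ) (a b : V t α) : ℕ :=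
  Set.ncard {r : V t α | Elem t α r ∧ Le t α a r ∧ Le t α r b}

/-- the span of the toggleability statistics `{T_p : p ∈ F}`. -/
noncomputable def ToggSpan (t : ℕ) (α : ℕ → ℕ) : Submodule ℝ (J t α → ℝ) :=
  Submodule.span ℝ {f | ∃ p : V t α, Elem t α p ∧ f = Tg t α p}

/-- `f ≡ g`: `f - g` is an `ℝ`-linear combination of toggleability statistics. -/
def Equiv' (t : ℕ) (α : ℕ → ℕ) (f g : J t α → ℝ) : Prop := f - g ∈ ToggSpan t α

/-- statistics of the form `const + linear combination of toggleability statistics`. -/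
noncomputable def ConstPlusTogg (t : ℕ) (α : ℕ → ℕ) : Submodule ℝ (J t α → ℝ) :=
  ToggSpan t α ⊔ Submodule.span ℝ {fun _ : J t α => (1 : ℝ)}

/-- the span of the antichain indicator functions `{χ_p : p ∈ F}`. -/
noncomputable def chiSpan (t : ℕ) (α : ℕ → ℕ) : Submodule ℝ (J t α → ℝ) :=
  Submodule.span ℝ {f | ∃ p : V t α, Elem t α p ∧ f = chi t α p}

/-- the span of the order-ideal indicator functions `{χ̂_p : p ∈ F}`. -/
noncomputable def chiHatSpan (t : ℕ) (α : ℕ → ℕ) : Submodule ℝ (J t α → ℝ) :=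
  Submodule.span ℝ {f | ∃ p : V t α, Elem t α p ∧ f = chiHat t α p}

/-- the antichain toggleability space `A_T(F)`. -/
noncomputable def AT (t : ℕ) (α : ℕ → ℕ) : Submodule ℝ (J t α → ℝ) :=
  chiSpan t α ⊓ ConstPlusTogg t α

/-- the order ideal toggleability space `I_T(F)`. -/
noncomputable def IT (t : ℕ) (α : ℕ → ℕ) : Submodule ℝ (J t α → ℝ) :=
  chiHatSpan t α ⊓ ConstPlusTogg t α

/-- the shared element `s_i = x_{m_i}` (for `1 ≤ i ≤ t-1`); the sentinels `i = 0` and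
`i = t` give the dummy vertex `0`, so statistics indexed by them vanish. -/
def sElx (t : ℕ) (α : ℕ → ℕ) (i : ℕ) : V t α := xel t α (m α i)

/-- 1-based index of the unshared element `s_{(i,j)}` (the `j`-th smallest unshared
element of the segment `S_i`, in the order of the fence). -/
def uEl (α : ℕ → ℕ) (i j : ℕ) : ℕ :=
  if (i - 1) % 2 = 0 then m α (i - 1) + j else m α i - j

def uElx (t : ℕ) (α : ℕ → ℕ) (i j : ℕ) : V t α := xel t α (uEl α i j)

/-- 1-based index of the peak of segment `S_i` (sentinel `0` if it does not exist). -/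
def peakN (t : ℕ) (α : ℕ → ℕ) (i : ℕ) : ℕ :=
  if i % 2 = 1 then (if i + 1 ≤ t then m α i else 0) else m α (i - 1)

/-- 1-based index of the valley of segment `S_i` (sentinel `0` if it does not exist). -/
def valleyN (t : ℕ) (α : ℕ → ℕ) (i : ℕ) : ℕ :=
  if i % 2 = 1 then (if 2 ≤ i then m α (i - 1) else 0) else (if i + 1 ≤ t then m α i else 0)

def peakx (t : ℕ) (α : ℕ → ℕ) (i : ℕ) : V t α := xel t α (peakN t α i)
def valleyx (t : ℕ) (α : ℕ → ℕ) (i : ℕ) : V t α := xel t α (valleyN t α i)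

/-- segment `S_i` has a peak. -/
def HasPeak (t i : ℕ) : Prop := i % 2 = 0 ∨ i + 1 ≤ t

/-- segment `S_i` has a valley. -/
def HasValley (t i : ℕ) : Prop := (i % 2 = 1 ∧ 2 ≤ i) ∨ (i % 2 = 0 ∧ i + 1 ≤ t)

/-- `p` is a shared element of the fence. -/
def IsSharedElem (t : ℕ) (α : ℕ → ℕ) (p : V t α) : Prop :=
  ∃ i, 1 ≤ i ∧ i + 1 ≤ t ∧ p = sElx t α i

/-- `p` is a peak of the fence. -/
def IsPeakElem (t : ℕ) (α : ℕ → ℕ) (p : V t α) : Prop :=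
  ∃ i, 1 ≤ i ∧ i + 1 ≤ t ∧ i % 2 = 1 ∧ p = sElx t α i

/-- span of the antichain indicators of the shared elements. -/
noncomputable def chiSharedSpan (t : ℕ) (α : ℕ → ℕ) : Submodule ℝ (J t α → ℝ) :=
  Submodule.span ℝ {f | ∃ i, 1 ≤ i ∧ i + 1 ≤ t ∧ f = chi t α (sElx t α i)}

/-- span of the order-ideal indicators of the shared elements. -/
noncomputable def chiHatSharedSpan (t : ℕ) (α : ℕ → ℕ) : Submodule ℝ (J t α → ℝ) :=
  Submodule.span ℝ {f | ∃ i, 1 ≤ i ∧ i + 1 ≤ t ∧ f = chiHat t α (sElx t α i)}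

theorem cov_elem {t : ℕ} {α : ℕ → ℕ} {a b : V t α} (h : Cov t α a b) :
    Elem t α a ∧ Elem t α b := by
  obtain ⟨i, hi, hd, h1, h2, h3, h4⟩ := h
  constructor <;> (simp only [Elem]; omega)

theorem le_elem {t : ℕ} {α : ℕ → ℕ} {a b : V t α} (h : Le t α a b) (hb : Elem t α b) :
    Elem t α a := by
  induction h using Relation.ReflTransGen.head_induction_on with
  | refl => exact hb
  | head hc _ _ => exact (cov_elem hc).1

/-- rowmotion: `ρ(I)` is the order ideal generated by the minimal elements of the
complement of `I`. -/
noncomputable def rho (t : ℕ) (α : ℕ → ℕ) (I : J t α) : J t α :=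
  ⟨{q | ∃ p : V t α, MinOut t α I.1 p ∧ Le t α q p}, by
    constructor
    · rintro q ⟨p, hp, hle⟩
      exact le_elem hle hp.1
    · rintro a b hab ⟨p, hp, hle⟩
      exact ⟨p, hp, Relation.ReflTransGen.trans hab hle⟩⟩

/-- the (forward) orbit of `x` under `ρ`. -/
def orbit {X : Type*} (ρ : X → X) (x : X) : Set X := {y | ∃ k : ℕ, ρ^[k] x = y}

/-- `f` is `c`-mesic under `ρ`: the sum of `f` over each orbit is `c` times
the orbit size. -/
def IsMesic {X : Type*} (ρ : X → X) (f : X → ℝ) (c : ℝ) : Prop :=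
  ∀ x : X, ∑ᶠ y ∈ orbit ρ x, f y = (orbit ρ x).ncard * c


theorem m_lt {t : ℕ} {α : ℕ → ℕ} (hF : IsFence t α) {a b : ℕ} (hab : a < b) (hb : b ≤ t) :
    m α a < m α b := by
  induction b with
  | zero => omega
  | succ b ih =>
    have h1 : m α (b + 1) = m α b + α b := by simp [m, Finset.sum_range_succ]
    have h2 := hF.2.1 b (by omega)
    rcases Nat.lt_succ_iff_lt_or_eq.mp hab with h | h
    · have := ih h (by omega)
      omega
    · subst h
      omega

theorem seg_unique {t : ℕ} {α : ℕ → ℕ} (hF : IsFence t α) {a b x : ℕ} (ha : a < t) (hb : b < t)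
    (h1 : m α a ≤ x) (h2 : x < m α (a + 1)) (h3 : m α b ≤ x) (h4 : x < m α (b + 1)) : a = b := by
  rcases lt_trichotomy a b with h | h | h
  · rcases Nat.lt_or_ge (a + 1) b with h' | h'
    · have := m_lt hF h' (by omega)
      omega
    · have : a + 1 = b := by omega
      subst this
      omega
  · exact h
  · rcases Nat.lt_or_ge (b + 1) a with h' | h'
    · have := m_lt hF h' (by omega)
      omega
    · have : b + 1 = a := by omega
      subst this
      omega

/-- basic numerical data of the segment `S_i`. -/
theorem seg_data {t : ℕ} {α : ℕ → ℕ} (hF : IsFence t α) {i : ℕ} (hi1 : 1 ≤ i) (hit : i ≤ t) :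
    m α i = m α (i - 1) + α (i - 1) ∧ nn t α + 1 = m α t ∧ m α i ≤ m α t ∧
      (i < t → m α i < m α t) ∧ (i = t → m α i = m α t) ∧ (1 < i → 1 ≤ m α (i - 1)) ∧
      (i = 1 → m α (i - 1) = 0) := by
  have h0 : m α 0 = 0 := by simp [m]
  have ht := hF.1
  have h1 : m α i = m α (i - 1) + α (i - 1) := by
    obtain ⟨s, rfl⟩ : ∃ s, i = s + 1 := ⟨i - 1, by omega⟩
    simp [m, Finset.sum_range_succ]
  have h2 : i < t → m α i < m α t := fun h => m_lt hF h le_rfl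
  have h3 : i = t → m α i = m α t := fun h => by rw [h]
  have h4 : m α 0 < m α t := m_lt hF (by omega) le_rfl
  have h5 : 1 < i → m α 0 < m α (i - 1) := fun h => m_lt hF (by omega) (by omega)
  refine ⟨h1, by unfold nn; omega, ?_, h2, h3, fun h => by have := h5 h; omega, ?_⟩
  · rcases Nat.lt_or_ge i t with h | h
    · exact (h2 h).le
    · exact (h3 (by omega)).le
  · rintro rfl
    exact h0

theorem xel_val {t : ℕ} {α : ℕ → ℕ} (j : ℕ) (hj : j ≤ nn t α + 1) :
    (j < nn t α + 1 ∧ (xel t α j : ℕ) = j) ∨ (j = nn t α + 1 ∧ (xel t α j : ℕ) = 0) := by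
  rcases Nat.lt_or_ge j (nn t α + 1) with h | h
  · left
    exact ⟨h, Nat.mod_eq_of_lt h⟩
  · right
    have : j = nn t α + 1 := by omega
    refine ⟨this, ?_⟩
    rw [this]
    simp [xel]

theorem valley_eq {t : ℕ} {α : ℕ → ℕ} (hF : IsFence t α) {i : ℕ} (hi1 : 1 ≤ i) (hit : i ≤ t) :
    valleyx t α i = uElx t α i 0 := by
  obtain ⟨h1, h2, h3, h4, h5, h6, h7⟩ := seg_data hF hi1 hit
  apply Fin.ext
  unfold valleyx uElx valleyN uEl
  have v0 := xel_val (t := t) (α := α) 0 (by omega)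
  have v1 := xel_val (t := t) (α := α) (m α (i - 1)) (by omega)
  have v2 := xel_val (t := t) (α := α) (m α i) (by omega)
  simp only [Nat.add_zero, Nat.sub_zero]
  split_ifs <;> omega

theorem peak_eq {t : ℕ} {α : ℕ → ℕ} (hF : IsFence t α) {i : ℕ} (hi1 : 1 ≤ i) (hit : i ≤ t) :
    peakx t α i = uElx t α i (α (i - 1)) := by
  obtain ⟨h1, h2, h3, h4, h5, h6, h7⟩ := seg_data hF hi1 hit
  apply Fin.ext
  unfold peakx uElx peakN uEl
  have e : m α i - α (i - 1) = m α (i - 1) := by omega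
  rw [e, ← h1]
  have v0 := xel_val (t := t) (α := α) 0 (by omega)
  have v1 := xel_val (t := t) (α := α) (m α (i - 1)) (by omega)
  have v2 := xel_val (t := t) (α := α) (m α i) (by omega)
  split_ifs <;> omega

/-- value of the `k`-th element of the segment. -/
theorem c_val {t : ℕ} {α : ℕ → ℕ} (hF : IsFence t α) {i : ℕ} (hi1 : 1 ≤ i) (hit : i ≤ t)
    {k : ℕ} (hk : k ≤ α (i - 1)) :
    (i % 2 = 1 ∧ m α (i - 1) + k < m α t ∧ (uElx t α i k : ℕ) = m α (i - 1) + k) ∨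
    (i % 2 = 1 ∧ i = t ∧ k = α (i - 1) ∧ (uElx t α i k : ℕ) = 0) ∨
    (i % 2 = 0 ∧ m α i - k < m α t ∧ (uElx t α i k : ℕ) = m α i - k) ∨
    (i % 2 = 0 ∧ i = t ∧ k = 0 ∧ (uElx t α i k : ℕ) = 0) := by
  obtain ⟨h1, h2, h3, h4, h5, h6, h7⟩ := seg_data hF hi1 hit
  unfold uElx uEl
  have v1 := xel_val (t := t) (α := α) (m α (i - 1) + k) (by omega)
  have v2 := xel_val (t := t) (α := α) (m α i - k) (by omega)
  split_ifs <;> omega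

theorem c_inj {t : ℕ} {α : ℕ → ℕ} (hF : IsFence t α) {i : ℕ} (hi1 : 1 ≤ i) (hit : i ≤ t)
    {k l : ℕ} (hk : k ≤ α (i - 1)) (hl : l ≤ α (i - 1)) (h : uElx t α i k = uElx t α i l) :
    k = l := by
  obtain ⟨h1, h2, h3, h4, h5, h6, h7⟩ := seg_data hF hi1 hit
  have hh : (uElx t α i k : ℕ) = uElx t α i l := by rw [h]
  have ht := hF.1
  have a1 := c_val hF hi1 hit hk
  have a2 := c_val hF hi1 hit hl
  omega

theorem c_elem {t : ℕ} {α : ℕ → ℕ} (hF : IsFence t α) {i : ℕ} (hi1 : 1 ≤ i) (hit : i ≤ t)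
    {k : ℕ} (hk1 : 1 ≤ k) (hk : k < α (i - 1)) : Elem t α (uElx t α i k) := by
  obtain ⟨h1, h2, h3, h4, h5, h6, h7⟩ := seg_data hF hi1 hit
  have a1 := c_val hF hi1 hit hk.le
  unfold Elem
  omega

theorem c_cov {t : ℕ} {α : ℕ → ℕ} (hF : IsFence t α) {i : ℕ} (hi1 : 1 ≤ i) (hit : i ≤ t)
    {k : ℕ} (hk : k < α (i - 1)) (e1 : Elem t α (uElx t α i k))
    (e2 : Elem t α (uElx t α i (k + 1))) : Cov t α (uElx t α i k) (uElx t α i (k + 1)) := by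
  obtain ⟨h1, h2, h3, h4, h5, h6, h7⟩ := seg_data hF hi1 hit
  have a1 := c_val hF hi1 hit hk.le
  have a2 := c_val hF hi1 hit (k := k + 1) (by omega)
  unfold Elem at e1 e2
  have e : i - 1 + 1 = i := by omega
  refine ⟨i - 1, by omega, ?_⟩
  rw [e]
  omega

theorem c_up {t : ℕ} {α : ℕ → ℕ} (hF : IsFence t α) {i : ℕ} (hi1 : 1 ≤ i) (hit : i ≤ t)
    {k : ℕ} (hk1 : 1 ≤ k) (hk : k ≤ α (i - 1)) {q : V t α} (h : Cov t α (uElx t α i k) q) :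
    k < α (i - 1) ∧ q = uElx t α i (k + 1) := by
  obtain ⟨h1, h2, h3, h4, h5, h6, h7⟩ := seg_data hF hi1 hit
  have a1 := c_val hF hi1 hit hk
  have e : i - 1 + 1 = i := by omega
  obtain ⟨s, hs, hd, b1, b2, b3, b4⟩ := h
  have u1 : ∀ x, m α s ≤ x → x < m α (s + 1) → m α (i - 1) ≤ x → x < m α i → s = i - 1 :=
    fun x p1 p2 p3 p4 => seg_unique hF hs (by omega) p1 p2 p3 (by rw [e]; exact p4)
  have u2 : i < t → s ≠ i → m α s ≤ m α i → m α i < m α (s + 1) → False :=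
    fun p0 p1 p2 p3 => p1 (seg_unique hF hs p0 p2 p3 le_rfl (m_lt hF (by omega) (by omega)))
  have u3 : 1 < i → s ≠ i - 2 → m α s ≤ m α (i - 1) - 1 → m α (i - 1) - 1 < m α (s + 1) →
      False := by
    intro p0 p1 p2 p3
    have e' : i - 2 + 1 = i - 1 := by omega
    have := m_lt hF (a := i - 2) (b := i - 1) (by omega) (by omega)
    exact p1 (seg_unique hF hs (by omega) p2 p3 (by omega) (by rw [e']; omega))
  have key : s = i - 1 ∧ k < α (i - 1) := by
    rcases hd with ⟨d1, d2⟩ | ⟨d1, d2⟩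
    · rw [Nat.min_eq_left (by omega)] at b1 b2 b3
      have := u1 _ b1 b2
      rcases a1 with a1 | a1 | a1 | a1
      · rcases Nat.lt_or_ge k (α (i - 1)) with hh | hh
        · exact ⟨this (by omega) (by omega), hh⟩
        · have ee : (uElx t α i k : ℕ) = m α i := by omega
          rw [ee] at b1 b2
          exact (u2 (by omega) (by omega) b1 b2).elim
      · omega
      · have := this (by omega) (by omega)
        omega
      · omega
    · rw [Nat.min_eq_right (by omega)] at b1 b2 b3
      have := u1 _ b1 b2
      rcases a1 with a1 | a1 | a1 | a1
      · have := this (by omega) (by omega)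
        omega
      · omega
      · rcases Nat.lt_or_ge k (α (i - 1)) with hh | hh
        · exact ⟨this (by omega) (by omega), hh⟩
        · have ee : (q : ℕ) = m α (i - 1) - 1 := by omega
          rw [ee] at b1 b2
          exact (u3 (by omega) (by omega) b1 b2).elim
      · omega
  refine ⟨key.2, Fin.ext ?_⟩
  have a2 := c_val hF hi1 hit (k := k + 1) (by omega)
  have := q.isLt
  have := key.1
  omega

theorem c_down {t : ℕ} {α : ℕ → ℕ} (hF : IsFence t α) {i : ℕ} (hi1 : 1 ≤ i) (hit : i ≤ t)
    {k : ℕ} (hk : k < α (i - 1)) {q : V t α} (h : Cov t α q (uElx t α i k)) :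
    1 ≤ k ∧ q = uElx t α i (k - 1) := by
  obtain ⟨h1, h2, h3, h4, h5, h6, h7⟩ := seg_data hF hi1 hit
  have a1 := c_val hF hi1 hit hk.le
  have e : i - 1 + 1 = i := by omega
  obtain ⟨s, hs, hd, b1, b2, b3, b4⟩ := h
  have u1 : ∀ x, m α s ≤ x → x < m α (s + 1) → m α (i - 1) ≤ x → x < m α i → s = i - 1 :=
    fun x p1 p2 p3 p4 => seg_unique hF hs (by omega) p1 p2 p3 (by rw [e]; exact p4)
  have u2 : i < t → s ≠ i → m α s ≤ m α i → m α i < m α (s + 1) → False :=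
    fun p0 p1 p2 p3 => p1 (seg_unique hF hs p0 p2 p3 le_rfl (m_lt hF (by omega) (by omega)))
  have u3 : 1 < i → s ≠ i - 2 → m α s ≤ m α (i - 1) - 1 → m α (i - 1) - 1 < m α (s + 1) →
      False := by
    intro p0 p1 p2 p3
    have e' : i - 2 + 1 = i - 1 := by omega
    have := m_lt hF (a := i - 2) (b := i - 1) (by omega) (by omega)
    exact p1 (seg_unique hF hs (by omega) p2 p3 (by omega) (by rw [e']; omega))
  have key : s = i - 1 ∧ 1 ≤ k := by
    rcases hd with ⟨d1, d2⟩ | ⟨d1, d2⟩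
    · rw [Nat.min_eq_left (by omega)] at b1 b2 b3
      have := u1 _ b1 b2
      rcases a1 with a1 | a1 | a1 | a1
      · rcases Nat.eq_zero_or_pos k with hh | hh
        · have ee : (q : ℕ) = m α (i - 1) - 1 := by omega
          rw [ee] at b1 b2
          exact (u3 (by omega) (by omega) b1 b2).elim
        · exact ⟨this (by omega) (by omega), hh⟩
      · omega
      · have := this (by omega) (by omega)
        omega
      · omega
    · rw [Nat.min_eq_right (by omega)] at b1 b2 b3
      have := u1 _ b1 b2
      rcases a1 with a1 | a1 | a1 | a1
      · have := this (by omega) (by omega)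
        omega
      · omega
      · rcases Nat.eq_zero_or_pos k with hh | hh
        · have ee : (uElx t α i k : ℕ) = m α i := by omega
          rw [ee] at b1 b2
          exact (u2 (by omega) (by omega) b1 b2).elim
        · exact ⟨this (by omega) (by omega), hh⟩
      · omega
  refine ⟨key.2, Fin.ext ?_⟩
  have a2 := c_val hF hi1 hit (k := k - 1) (by omega)
  have := q.isLt
  have := key.1
  omega

theorem c_le_up {t : ℕ} {α : ℕ → ℕ} (hF : IsFence t α) {i : ℕ} (hi1 : 1 ≤ i) (hit : i ≤ t)
    {l : ℕ} (hl1 : 1 ≤ l) (hl : l ≤ α (i - 1)) {q : V t α} (h : Le t α (uElx t α i l) q) :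
    ∃ k, l ≤ k ∧ k ≤ α (i - 1) ∧ q = uElx t α i k := by
  induction h with
  | refl => exact ⟨l, le_rfl, hl, rfl⟩
  | tail _ hc ih =>
    obtain ⟨k, k1, k2, rfl⟩ := ih
    obtain ⟨k3, k4⟩ := c_up hF hi1 hit (by omega) k2 hc
    exact ⟨k + 1, by omega, by omega, k4⟩

theorem c_le_down {t : ℕ} {α : ℕ → ℕ} (hF : IsFence t α) {i : ℕ} (hi1 : 1 ≤ i) (hit : i ≤ t)
    {l : ℕ} (hl : l < α (i - 1)) {q : V t α} (h : Le t α q (uElx t α i l)) :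
    ∃ k, k ≤ l ∧ q = uElx t α i k := by
  induction h using Relation.ReflTransGen.head_induction_on with
  | refl => exact ⟨l, le_rfl, rfl⟩
  | head hc _ ih =>
    obtain ⟨k, k1, rfl⟩ := ih
    obtain ⟨k3, k4⟩ := c_down hF hi1 hit (by omega) hc
    exact ⟨k - 1, by omega, k4⟩

theorem c_le {t : ℕ} {α : ℕ → ℕ} (hF : IsFence t α) {i : ℕ} (hi1 : 1 ≤ i) (hit : i ≤ t)
    {k l : ℕ} (hk : 1 ≤ k) (hkl : k ≤ l) (hl : l < α (i - 1)) :
    Le t α (uElx t α i k) (uElx t α i l) := by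
  induction l, hkl using Nat.le_induction with
  | base => exact Relation.ReflTransGen.refl
  | succ l hkl ih =>
    exact (ih (by omega)).tail (c_cov hF hi1 hit (by omega)
      (c_elem hF hi1 hit (by omega) (by omega)) (c_elem hF hi1 hit (by omega) hl))

theorem interval_iff {t : ℕ} {α : ℕ → ℕ} (hF : IsFence t α) {i : ℕ} (hi1 : 1 ≤ i) (hit : i ≤ t)
    {l r : ℕ} (hl1 : 1 ≤ l) (hl : l < α (i - 1)) (hr : r < α (i - 1)) (u : V t α) :
    (Elem t α u ∧ Le t α (uElx t α i l) u ∧ Le t α u (uElx t α i r)) ↔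
      ∃ k, (l ≤ k ∧ k ≤ r) ∧ uElx t α i k = u := by
  constructor
  · rintro ⟨_, h2, h3⟩
    obtain ⟨k, k1, k2, rfl⟩ := c_le_up hF hi1 hit hl1 hl.le h2
    obtain ⟨k', k3, k4⟩ := c_le_down hF hi1 hit hr h3
    have := c_inj hF hi1 hit k2 (by omega) k4
    exact ⟨k, ⟨k1, by omega⟩, rfl⟩
  · rintro ⟨k, ⟨k1, k2⟩, rfl⟩
    exact ⟨c_elem hF hi1 hit (by omega) (by omega), c_le hF hi1 hit hl1 k1 (by omega),
      c_le hF hi1 hit (by omega) k2 hr⟩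

theorem icard_eq {t : ℕ} {α : ℕ → ℕ} (hF : IsFence t α) {i : ℕ} (hi1 : 1 ≤ i) (hit : i ≤ t)
    {l r : ℕ} (hl1 : 1 ≤ l) (hl : l < α (i - 1)) (hr : r < α (i - 1)) :
    icard t α (uElx t α i l) (uElx t α i r) = r + 1 - l := by
  have : {u : V t α | Elem t α u ∧ Le t α (uElx t α i l) u ∧ Le t α u (uElx t α i r)}
      = (uElx t α i) '' (Finset.Icc l r : Finset ℕ) := by
    ext u
    simp only [Set.mem_ofPred_eq, interval_iff hF hi1 hit hl1 hl hr, Set.mem_image,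
      Finset.mem_coe, Finset.mem_Icc]
  unfold icard
  rw [this, Set.InjOn.ncard_image, Set.ncard_coe_finset, Nat.card_Icc]
  intro a ha b hb h
  simp only [Finset.mem_coe, Finset.mem_Icc] at ha hb
  exact c_inj hF hi1 hit (by omega) (by omega) h

theorem cov_ne {t : ℕ} {α : ℕ → ℕ} {a b : V t α} (h : Cov t α a b) : a ≠ b := by
  rintro rfl
  obtain ⟨s, _, hd, _⟩ := h
  omega

theorem maxIn_iff {t : ℕ} {α : ℕ → ℕ} (I : J t α) (p : V t α) :
    MaxIn t α I.1 p ↔ p ∈ I.1 ∧ ∀ q, Cov t α p q → q ∉ I.1 := by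
  constructor
  · rintro ⟨h1, h2⟩
    exact ⟨h1, fun q hc hq => cov_ne hc (h2 q hq (Relation.ReflTransGen.single hc)).symm⟩
  · rintro ⟨h1, h2⟩
    refine ⟨h1, fun q hq hle => ?_⟩
    rcases Relation.ReflTransGen.cases_head hle with h | ⟨r, hr, hrq⟩
    · exact h.symm
    · exact (h2 r hr (I.2.2 r q hrq hq)).elim

theorem minOut_iff {t : ℕ} {α : ℕ → ℕ} (I : J t α) (p : V t α) :
    MinOut t α I.1 p ↔ Elem t α p ∧ p ∉ I.1 ∧ ∀ q, Cov t α q p → q ∈ I.1 := by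
  constructor
  · rintro ⟨h0, h1, h2⟩
    refine ⟨h0, h1, fun q hc => ?_⟩
    by_contra hq
    exact cov_ne hc (h2 q (cov_elem hc).1 hq (Relation.ReflTransGen.single hc))
  · rintro ⟨h0, h1, h2⟩
    refine ⟨h0, h1, fun q he hq hle => ?_⟩
    rcases Relation.ReflTransGen.cases_tail hle with h | ⟨r, hr, hrp⟩
    · exact h.symm
    · exact (hq (I.2.2 q r hr (h2 r hrp))).elim

theorem sum_lower (h : ℕ → ℝ) (j : ℕ) :
    ∑ k ∈ Finset.Icc 1 j, (k : ℝ) * (h (k - 1) - 2 * h k + h (k + 1))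
      = h 0 - (j + 1) * h j + j * h (j + 1) := by
  induction j with
  | zero => simp
  | succ j ih =>
    rw [Finset.sum_Icc_succ_top (by omega), ih]
    simp only [Nat.add_sub_cancel]
    push_cast
    ring

theorem sum_upper (h : ℕ → ℝ) (j d : ℕ) :
    ∑ k ∈ Finset.Ioc j (j + d), ((j : ℝ) + d + 1 - k) * (h (k - 1) - 2 * h k + h (k + 1))
      = d * h j - (d + 1) * h (j + 1) + h (j + d + 1) := by
  have aux : ∀ c : ℝ, ∑ k ∈ Finset.Ioc j (j + d), (c - k) * (h (k - 1) - 2 * h k + h (k + 1))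
      = (c - j - 1) * h j - (c - j) * h (j + 1) - (c - j - d - 1) * h (j + d)
        + (c - j - d) * h (j + d + 1) := by
    intro c
    induction d with
    | zero => simp
    | succ d ih =>
      rw [← add_assoc, Finset.sum_Ioc_succ_top (by omega), ih]
      simp only [Nat.add_sub_cancel]
      push_cast
      ring
  rw [aux]
  ring

theorem ind_chi {p q : Prop} (h : q → p) :
    (if p ∧ ¬ q then (1 : ℝ) else 0) = (if p then 1 else 0) - (if q then 1 else 0) := by
  by_cases hp : p <;> by_cases hq : q <;> simp_all

theorem ind_T {p q r : Prop} (h : q → p) (h' : p → r) :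
    (if r ∧ ¬ p then (1 : ℝ) else if p ∧ ¬ q then -1 else 0)
      = (if r then 1 else 0) - 2 * (if p then 1 else 0) + (if q then 1 else 0) := by
  by_cases hp : p <;> by_cases hq : q <;> by_cases hr : r <;> simp [hp, hq, hr] <;>
    norm_num
  all_goals tauto

theorem ind_zero {p q : Prop} (h : q → p) :
    (if q then (1 : ℝ) else 0) + (if ¬ p then 1 else if q then -1 else 0)
      = 1 - (if p then 1 else 0) := by
  by_cases hp : p <;> by_cases hq : q <;> simp_all

set_option maxHeartbeats 1000000 in
/-- Theorem `peak and valley anti`.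
For a fence `F = F̆(α₁,…,α_t)`, `i ∈ [t]` with `α_i ≥ 2`, `x = s_{(i,j)}` an unshared
element of `S_i`, `v` the valley and `p` the peak of `S_i` (zero statistic if nonexistent),
`y = s_{(i,1)}`, `z = s_{(i,β_i)}`:
`α_i·χ_x + χ_v + χ_p = 1 − T_v − Σ_{y ⊴ u ⊴ x} #[y,u]·T_u + Σ_{x ◁ u ⊴ z} #[u,z]·T_u`. -/
theorem statement0 (t : ℕ) (α : ℕ → ℕ) (hF : IsFence t α)
    (i : ℕ) (hi1 : 1 ≤ i) (hit : i ≤ t) (hαi : 2 ≤ α (i - 1))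
    (j : ℕ) (hj1 : 1 ≤ j) (hj2 : j ≤ α (i - 1) - 1) :
    ∀ I : J t α,
      (α (i - 1) : ℝ) * chi t α (uElx t α i j) I
          + chi t α (valleyx t α i) I + chi t α (peakx t α i) I
        = 1 - Tg t α (valleyx t α i) I
          - (∑ u ∈ Finset.univ.filter (fun u : V t α =>
                Elem t α u ∧ Le t α (uElx t α i 1) u ∧ Le t α u (uElx t α i j)),
              (icard t α (uElx t α i 1) u : ℝ) * Tg t α u I)
          + (∑ u ∈ Finset.univ.filter (fun u : V t α =>
                Elem t α u ∧ Le t α (uElx t α i j) u ∧ u ≠ uElx t α i j ∧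
                  Le t α u (uElx t α i (α (i - 1) - 1))),
              (icard t α u (uElx t α i (α (i - 1) - 1)) : ℝ) * Tg t α u I) := by
  intro I
  rw [valley_eq hF hi1 hit, peak_eq hF hi1 hit]
  set a := α (i - 1) with ha
  set c := uElx t α i with hc
  have up : ∀ {k}, 1 ≤ k → k ≤ a → ∀ {q}, Cov t α (c k) q → k < a ∧ q = c (k + 1) :=
    fun h1 h2 _ h => c_up hF hi1 hit h1 h2 h
  have down : ∀ {k}, k < a → ∀ {q}, Cov t α q (c k) → 1 ≤ k ∧ q = c (k - 1) :=
    fun h1 _ h => c_down hF hi1 hit h1 h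
  have el : ∀ {k}, 1 ≤ k → k < a → Elem t α (c k) := fun h1 h2 => c_elem hF hi1 hit h1 h2
  have cov : ∀ {k}, k < a → Elem t α (c k) → Elem t α (c (k + 1)) → Cov t α (c k) (c (k + 1)) :=
    fun h1 h2 h3 => c_cov hF hi1 hit h1 h2 h3
  -- the indicator function, with value `1` at a nonexistent valley
  let b : ℕ → Prop := fun k => c k ∈ I.1 ∨ (k = 0 ∧ ¬ Elem t α (c 0))
  let h : ℕ → ℝ := fun k => if b k then 1 else 0
  have bpos : ∀ k, 1 ≤ k → (b k ↔ c k ∈ I.1) := fun k hk => by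
    simp only [b]
    constructor
    · rintro (h | ⟨h, _⟩)
      · exact h
      · omega
    · exact Or.inl
  have bmono : ∀ k, k < a → b (k + 1) → b k := by
    intro k hk hb
    rw [bpos _ (by omega)] at hb
    have e2 := I.2.1 _ hb
    by_cases e1 : Elem t α (c k)
    · exact Or.inl (I.2.2 _ _ (Relation.ReflTransGen.single (cov hk e1 e2)) hb)
    · rcases Nat.eq_zero_or_pos k with h0 | h0
      · subst h0
        exact Or.inr ⟨rfl, e1⟩
      · exact (e1 (el h0 hk)).elim
  have maxk : ∀ k, 1 ≤ k → k < a → (MaxIn t α I.1 (c k) ↔ b k ∧ ¬ b (k + 1)) := by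
    intro k h1 h2
    rw [maxIn_iff, bpos k h1, bpos (k + 1) (by omega)]
    refine and_congr_right fun hk => ⟨fun hq hin => ?_, fun hn q hq => ?_⟩
    · exact hq _ (cov h2 (el h1 h2) (I.2.1 _ hin)) hin
    · rw [(up h1 h2.le hq).2]
      exact hn
  have mink : ∀ k, 1 ≤ k → k < a → (MinOut t α I.1 (c k) ↔ b (k - 1) ∧ ¬ b k) := by
    intro k h1 h2
    rw [minOut_iff, bpos k h1]
    obtain ⟨l, rfl⟩ : ∃ l, k = l + 1 := ⟨k - 1, by omega⟩
    simp only [Nat.add_sub_cancel]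
    constructor
    · rintro ⟨e, n, hq⟩
      refine ⟨?_, n⟩
      by_cases e1 : Elem t α (c l)
      · exact Or.inl (hq _ (cov (by omega) e1 e))
      · rcases Nat.eq_zero_or_pos l with h0 | h0
        · subst h0
          exact Or.inr ⟨rfl, e1⟩
        · exact (e1 (el h0 (by omega))).elim
    · rintro ⟨hb, n⟩
      refine ⟨el h1 h2, n, fun q hq => ?_⟩
      obtain ⟨_, rfl⟩ := down h2 hq
      rcases hb with hb | ⟨rfl, hb⟩
      · exact hb
      · exact (hb (cov_elem hq).1).elim
  have chik : ∀ k, 1 ≤ k → k < a → chi t α (c k) I = h k - h (k + 1) := by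
    intro k h1 h2
    have := bmono k h2
    simp only [chi, maxk k h1 h2, h]
    convert ind_chi this
  have Tk : ∀ k, 1 ≤ k → k < a → Tg t α (c k) I = h (k - 1) - 2 * h k + h (k + 1) := by
    intro k h1 h2
    have m1 := bmono k h2
    have m2 := bmono (k - 1) (by omega)
    rw [Nat.sub_add_cancel h1] at m2
    simp only [Tg, maxk k h1 h2, mink k h1 h2, h]
    convert ind_T m1 m2
  have chia : chi t α (c a) I = h a := by
    have : MaxIn t α I.1 (c a) ↔ b a := by
      rw [maxIn_iff, bpos a (by omega)]
      refine ⟨fun h => h.1, fun h => ⟨h, fun q hq => ?_⟩⟩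
      have := (up (by omega) le_rfl hq).1
      omega
    simp only [chi, this, h]
  have chi0 : chi t α (c 0) I + Tg t α (c 0) I = 1 - h 0 := by
    have h1 : MinOut t α I.1 (c 0) ↔ ¬ b 0 := by
      rw [minOut_iff]
      simp only [b, true_and, not_or, not_not]
      constructor
      · rintro ⟨e, n, _⟩
        exact ⟨n, e⟩
      · rintro ⟨n, e⟩
        refine ⟨e, n, fun q hq => ?_⟩
        have := (down (by omega) hq).1
        omega
    have h2 : MaxIn t α I.1 (c 0) → b 0 := fun h => Or.inl h.1
    simp only [chi, Tg, h1, h]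
    convert ind_zero h2
  have inj : ∀ s : Finset ℕ, (∀ k ∈ s, k ≤ a) → Set.InjOn c s := fun s hs k hk l hl hkl =>
    c_inj hF hi1 hit (hs k hk) (hs l hl) hkl
  have S1 : (∑ u ∈ Finset.univ.filter (fun u : V t α =>
                Elem t α u ∧ Le t α (c 1) u ∧ Le t α u (c j)),
              (icard t α (c 1) u : ℝ) * Tg t α u I)
      = ∑ k ∈ Finset.Icc 1 j, (k : ℝ) * (h (k - 1) - 2 * h k + h (k + 1)) := by
    have e : Finset.univ.filter (fun u : V t α =>
                Elem t α u ∧ Le t α (c 1) u ∧ Le t α u (c j)) = (Finset.Icc 1 j).image c := by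
      ext u
      simp only [Finset.mem_filter, Finset.mem_univ, true_and, Finset.mem_image, Finset.mem_Icc]
      exact interval_iff hF hi1 hit le_rfl (by omega) (by omega) u
    rw [e, Finset.sum_image (inj _ fun k hk => by rw [Finset.mem_Icc] at hk; omega)]
    refine Finset.sum_congr rfl fun k hk => ?_
    rw [Finset.mem_Icc] at hk
    rw [Tk k hk.1 (by omega), icard_eq hF hi1 hit le_rfl (by omega) (by omega)]
    simp
  obtain ⟨d, hd⟩ : ∃ d, a - 1 = j + d := ⟨a - 1 - j, by omega⟩
  have had : a = j + d + 1 := by omega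
  have S2 : (∑ u ∈ Finset.univ.filter (fun u : V t α =>
                Elem t α u ∧ Le t α (c j) u ∧ u ≠ c j ∧ Le t α u (c (a - 1))),
              (icard t α u (c (a - 1)) : ℝ) * Tg t α u I)
      = ∑ k ∈ Finset.Ioc j (j + d),
          ((j : ℝ) + d + 1 - k) * (h (k - 1) - 2 * h k + h (k + 1)) := by
    have e : Finset.univ.filter (fun u : V t α =>
                Elem t α u ∧ Le t α (c j) u ∧ u ≠ c j ∧ Le t α u (c (a - 1)))
        = (Finset.Ioc j (j + d)).image c := by
      ext u
      simp only [Finset.mem_filter, Finset.mem_univ, true_and, Finset.mem_image, Finset.mem_Ioc]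
      have key := interval_iff hF hi1 hit (l := j) (r := a - 1) hj1 (by omega) (by omega) u
      constructor
      · rintro ⟨p1, p2, p3, p4⟩
        obtain ⟨k, ⟨k1, k2⟩, k3⟩ := key.1 ⟨p1, p2, p4⟩
        refine ⟨k, ⟨?_, by omega⟩, k3⟩
        rcases Nat.lt_or_ge j k with hh | hh
        · exact hh
        · have : k = j := by omega
          subst this
          exact (p3 k3.symm).elim
      · rintro ⟨k, ⟨k1, k2⟩, k3⟩
        obtain ⟨p1, p2, p4⟩ := key.2 ⟨k, ⟨by omega, by omega⟩, k3⟩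
        refine ⟨p1, p2, ?_, p4⟩
        rintro rfl
        have := c_inj hF hi1 hit (by omega) (by omega) k3
        omega
    rw [e, Finset.sum_image (inj _ fun k hk => by rw [Finset.mem_Ioc] at hk; omega)]
    refine Finset.sum_congr rfl fun k hk => ?_
    rw [Finset.mem_Ioc] at hk
    rw [Tk k (by omega) (by omega), icard_eq hF hi1 hit (by omega) (by omega) (by omega)]
    have : a - 1 + 1 - k = j + d + 1 - k := by omega
    rw [this, Nat.cast_sub (by omega)]
    push_cast
    ring
  rw [S1, S2, sum_lower, sum_upper, chik j hj1 (by omega), chia]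
  have ca : (a : ℝ) = j + d + 1 := by
    rw [had]
    push_cast
    ring
  have cb : h a = h (j + d + 1) := by rw [had]
  rw [ca, cb]
  linear_combination chi0

end Fence
end

section
/- Let F = F̆(α_1,…,α_t) be a fence and let f : J(F) → ℝ lie in the ℝ-span of {χ_x : x ∈ F} or in the ℝ-span of {χ̂_x : x ∈ F}. Suppose f = c + Σ_{x ∈ F} c_x·T_x for real constants c and c_x (x ∈ F). Then c_p = 0 for every peak p ∈ F. If, in addition, f lies in the ℝ-span of {χ_{s_i} : 1 ≤ i ≤ t−1} or in the ℝ-span of {χ̂_{s_i} : 1 ≤ i ≤ t−1}, then also c_u = 0 for every unshared element u ∈ F. -/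
open scoped Classical

namespace Fence

section helpers

def DU (t : ℕ) (α : ℕ → ℕ) (j : ℕ) : Prop :=
  ∃ i < t, i % 2 = 0 ∧ m α i ≤ j ∧ j < m α (i + 1)

def DD (t : ℕ) (α : ℕ → ℕ) (j : ℕ) : Prop :=
  ∃ i < t, i % 2 = 1 ∧ m α i ≤ j ∧ j < m α (i + 1)

theorem m_mono {α : ℕ → ℕ} {i j : ℕ} (h : i ≤ j) : m α i ≤ m α j := by
  unfold m
  exact Finset.sum_le_sum_of_subset (Finset.range_mono h)

theorem m_succ (α : ℕ → ℕ) (i : ℕ) : m α (i + 1) = m α i + α i := by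
  unfold m
  exact Finset.sum_range_succ _ _

theorem not_DU_DD {t : ℕ} {α : ℕ → ℕ} {j : ℕ} (h : DU t α j) (h' : DD t α j) : False := by
  obtain ⟨i, hi, hp, h1, h2⟩ := h
  obtain ⟨k, hk, kp, k1, k2⟩ := h'
  rcases lt_trichotomy i k with h | h | h
  · have := m_mono (α := α) (show i + 1 ≤ k from h); omega
  · omega
  · have := m_mono (α := α) (show k + 1 ≤ i from h); omega

theorem exists_seg {α : ℕ → ℕ} {j : ℕ} : ∀ t, j < m α t → ∃ i < t, m α i ≤ j ∧ j < m α (i + 1)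
  | 0, h => by simp [m] at h
  | t + 1, h => by
    by_cases h' : j < m α t
    · obtain ⟨i, hi, h1⟩ := exists_seg t h'
      exact ⟨i, by omega, h1⟩
    · exact ⟨t, by omega, by omega, h⟩

theorem DU_or_DD {t : ℕ} {α : ℕ → ℕ} {j : ℕ} (h : j < m α t) : DU t α j ∨ DD t α j := by
  obtain ⟨i, hi, h1, h2⟩ := exists_seg t h
  rcases Nat.mod_two_eq_zero_or_one i with h | h
  · exact Or.inl ⟨i, hi, h, h1, h2⟩
  · exact Or.inr ⟨i, hi, h, h1, h2⟩

theorem cov_iff {t : ℕ} {α : ℕ → ℕ} {a b : V t α} : Cov t α a b ↔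
    ((b : ℕ) = a + 1 ∧ 1 ≤ (a : ℕ) ∧ DU t α a) ∨ ((a : ℕ) = b + 1 ∧ 1 ≤ (b : ℕ) ∧ DD t α b) := by
  have ha := a.2
  have hb := b.2
  constructor
  · rintro ⟨i, hi, h | h, h1, h2, h3, h4⟩
    · left
      exact ⟨h.2, by omega, i, hi, h.1, by omega, by omega⟩
    · right
      exact ⟨h.2, by omega, i, hi, h.1, by omega, by omega⟩
  · rintro (⟨h, h0, i, hi, h1, h2, h3⟩ | ⟨h, h0, i, hi, h1, h2, h3⟩)
    · have e : min (a : ℕ) b = a := by omega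
      exact ⟨i, hi, Or.inl ⟨h1, h⟩, by omega, by omega, by omega, by omega⟩
    · have e : min (a : ℕ) b = b := by omega
      exact ⟨i, hi, Or.inr ⟨h1, h⟩, by omega, by omega, by omega, by omega⟩

theorem cov_near {t : ℕ} {α : ℕ → ℕ} {a b : V t α} (h : Cov t α a b) :
    (b : ℕ) = a + 1 ∨ (a : ℕ) = b + 1 := by
  rcases cov_iff.1 h with h | h
  · exact Or.inl h.1
  · exact Or.inr h.1

theorem le_char {t : ℕ} {α : ℕ → ℕ} {a b : V t α} (h : Le t α a b) :
    ((a : ℕ) ≤ b ∧ ∀ j, (a : ℕ) ≤ j → j < b → DU t α j) ∨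
    ((b : ℕ) ≤ a ∧ ∀ j, (b : ℕ) ≤ j → j < a → DD t α j) := by
  induction h with
  | refl => left; exact ⟨le_rfl, fun j h1 h2 => by omega⟩
  | @tail b d hab hc ih =>
    rcases cov_iff.1 hc with ⟨h1, h2, h3⟩ | ⟨h1, h2, h3⟩
    · rcases ih with ⟨i1, i2⟩ | ⟨i1, i2⟩
      · left
        refine ⟨by omega, fun j j1 j2 => ?_⟩
        by_cases hj : j = b
        · rw [hj]; exact h3
        · exact i2 j j1 (by omega)
      · by_cases hab : (a : ℕ) = b
        · left
          refine ⟨by omega, fun j j1 j2 => ?_⟩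
          have hj : j = b := by omega
          rw [hj]; exact h3
        · exact (not_DU_DD h3 (i2 b le_rfl (by omega))).elim
    · rcases ih with ⟨i1, i2⟩ | ⟨i1, i2⟩
      · by_cases hab : (a : ℕ) = b
        · right
          refine ⟨by omega, fun j j1 j2 => ?_⟩
          have hj : j = d := by omega
          rw [hj]; exact h3
        · exact (not_DU_DD (i2 d (by omega) (by omega)) h3).elim
      · right
        refine ⟨by omega, fun j j1 j2 => ?_⟩
        by_cases hj : j = d
        · rw [hj]; exact h3
        · exact i2 j (by omega) j2

theorem le_antisymm' {t : ℕ} {α : ℕ → ℕ} {a b : V t α} (h : Le t α a b) (h' : Le t α b a) :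
    a = b := by
  by_contra hne
  have hne' : (a : ℕ) ≠ b := fun h => hne (Fin.ext h)
  rcases le_char h with ⟨h1, h2⟩ | ⟨h1, h2⟩ <;> rcases le_char h' with ⟨k1, k2⟩ | ⟨k1, k2⟩
  · omega
  · exact not_DU_DD (h2 a le_rfl (by omega)) (k2 a le_rfl (by omega))
  · exact not_DU_DD (k2 b le_rfl (by omega)) (h2 b le_rfl (by omega))
  · omega

/-- two ideals agree near `x` -/
def Near {t : ℕ} {α : ℕ → ℕ} (I I' : J t α) (x : V t α) : Prop :=
  ∀ y : V t α, (y : ℕ) ≤ x + 1 → (x : ℕ) ≤ y + 1 → (y ∈ I.1 ↔ y ∈ I'.1)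

theorem near_max {t : ℕ} {α : ℕ → ℕ} {I I' : J t α} {x : V t α} (h : Near I I' x) :
    MaxIn t α I.1 x ↔ MaxIn t α I'.1 x := by
  rw [maxIn_iff, maxIn_iff, h x (by omega) (by omega)]
  refine and_congr_right fun _ => forall_congr' fun q => ?_
  refine imp_congr_right fun hc => ?_
  have := cov_near hc
  rw [h q (by omega) (by omega)]

theorem near_min {t : ℕ} {α : ℕ → ℕ} {I I' : J t α} {x : V t α} (h : Near I I' x) :
    MinOut t α I.1 x ↔ MinOut t α I'.1 x := by
  rw [minOut_iff, minOut_iff, h x (by omega) (by omega)]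
  refine and_congr_right fun _ => and_congr_right fun _ => forall_congr' fun q => ?_
  refine imp_congr_right fun hc => ?_
  have := cov_near hc
  rw [h q (by omega) (by omega)]

theorem near_chi {t : ℕ} {α : ℕ → ℕ} {I I' : J t α} {x : V t α} (h : Near I I' x) :
    chi t α x I = chi t α x I' := by
  simp only [chi, near_max h]

theorem near_Tg {t : ℕ} {α : ℕ → ℕ} {I I' : J t α} {x : V t α} (h : Near I I' x) :
    Tg t α x I = Tg t α x I' := by
  simp only [Tg, near_max h, near_min h]

theorem near_chiHat {t : ℕ} {α : ℕ → ℕ} {I I' : J t α} {x : V t α} (h : Near I I' x) :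
    chiHat t α x I = chiHat t α x I' := by
  simp only [chiHat, h x (by omega) (by omega)]

/-- The ideal of elements not above any element of `A`, together with `B ⊆ A`. -/
theorem ideal_aux {t : ℕ} {α : ℕ → ℕ} (A B : Set (V t α))
    (hB : ∀ b ∈ B, Elem t α b) (hBA : B ⊆ A)
    (hanti : ∀ a ∈ A, ∀ b ∈ A, Le t α a b → a = b) :
    IsIdeal t α {x | (Elem t α x ∧ ∀ a ∈ A, ¬ Le t α a x) ∨ x ∈ B} := by
  constructor
  · rintro p (h | h)
    · exact h.1
    · exact hB p h
  · rintro x y hxy (h | h)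
    · exact Or.inl ⟨le_elem hxy h.1, fun a ha hax => h.2 a ha (hax.trans hxy)⟩
    · by_cases hx : ∃ a ∈ A, Le t α a x
      · obtain ⟨a, ha, hax⟩ := hx
        have e := hanti a ha y (hBA h) (hax.trans hxy)
        subst e
        right
        rw [← le_antisymm' hax hxy]
        exact h
      · push Not at hx
        exact Or.inl ⟨le_elem hxy (hB y h), hx⟩

theorem seg_change {t : ℕ} {α : ℕ → ℕ} {x : V t α} {k : ℕ} (hk : (x : ℕ) = k + 1)
    (h : (DU t α k ∧ DD t α x) ∨ (DD t α k ∧ DU t α x)) : IsSharedElem t α x := by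
  have key : ∀ i j, i < t → j < t → i % 2 ≠ j % 2 → m α i ≤ k → k < m α (i + 1) →
      m α j ≤ x → (x : ℕ) < m α (j + 1) → IsSharedElem t α x := by
    intro i j hi hj hij h1 h2 h3 h4
    rcases lt_trichotomy i j with h | h | h
    · have := m_mono (α := α) (show i + 1 ≤ j from h)
      refine ⟨i + 1, by omega, by omega, Fin.ext ?_⟩
      have e : m α (i + 1) = x := by omega
      simp only [sElx, xel, e]
      exact (Nat.mod_eq_of_lt x.2).symm
    · omega
    · have := m_mono (α := α) (show j + 1 ≤ i from h); omega
  rcases h with ⟨⟨i, hi, a1, a2, a3⟩, ⟨j, hj, b1, b2, b3⟩⟩ | ⟨⟨i, hi, a1, a2, a3⟩, ⟨j, hj, b1, b2, b3⟩⟩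
  · exact key i j hi hj (by omega) a2 a3 b2 b3
  · exact key i j hi hj (by omega) a2 a3 b2 b3

theorem shared_info {t : ℕ} {α : ℕ → ℕ} (hF : IsFence t α) {i : ℕ} (h1 : 1 ≤ i)
    (h2 : i + 1 ≤ t) : ((sElx t α i : V t α) : ℕ) = m α i ∧ 2 ≤ m α i ∧ m α i + 1 ≤ nn t α ∧
    (i % 2 = 1 → DU t α (m α i - 1) ∧ DD t α (m α i)) ∧
    (i % 2 = 0 → DD t α (m α i - 1) ∧ DU t α (m α i)) := by
  obtain ⟨ht, hpos, hα0, hαt⟩ := hF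
  have e1 : 2 ≤ m α i := by
    have := m_mono (α := α) h1
    have h' := m_succ α 0
    simp only [m, Finset.range_zero, Finset.sum_empty, zero_add] at h' this ⊢
    omega
  have e2 : m α i + 2 ≤ m α t := by
    have := m_mono (α := α) (show i ≤ t - 1 by omega)
    have h' := m_succ α (t - 1)
    rw [show t - 1 + 1 = t by omega] at h'
    omega
  have e3 : m α (i + 1) = m α i + α i := m_succ α i
  have e4 : m α (i - 1 + 1) = m α (i - 1) + α (i - 1) := m_succ α (i - 1)
  have e5 : m α (i - 1 + 1) = m α i := by rw [show i - 1 + 1 = i by omega]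
  have p1 := hpos i (by omega)
  have p2 := hpos (i - 1) (by omega)
  refine ⟨?_, e1, by unfold nn; omega, fun h => ⟨?_, ?_⟩, fun h => ⟨?_, ?_⟩⟩
  · simp only [sElx, xel]
    exact Nat.mod_eq_of_lt (by unfold nn; omega)
  · exact ⟨i - 1, by omega, by omega, by omega, by omega⟩
  · exact ⟨i, by omega, by omega, by omega, by omega⟩
  · exact ⟨i - 1, by omega, by omega, by omega, by omega⟩
  · exact ⟨i, by omega, by omega, by omega, by omega⟩

/-- evaluation at an ideal, as a linear map -/
def ev {t : ℕ} {α : ℕ → ℕ} (I : J t α) : (J t α → ℝ) →ₗ[ℝ] ℝ where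
  toFun g := g I
  map_add' _ _ := rfl
  map_smul' _ _ := rfl

theorem span_kill {t : ℕ} {α : ℕ → ℕ} (L : (J t α → ℝ) →ₗ[ℝ] ℝ) {S : Set (J t α → ℝ)}
    (hS : ∀ g ∈ S, L g = 0) {f : J t α → ℝ} (hf : f ∈ Submodule.span ℝ S) : L f = 0 := by
  have : Submodule.span ℝ S ≤ LinearMap.ker L := Submodule.span_le.2 fun g hg => hS g hg
  exact this hf

theorem rep_apply {t : ℕ} {α : ℕ → ℕ} (L : (J t α → ℝ) →ₗ[ℝ] ℝ) (hL : L (fun _ => 1) = 0)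
    {f : J t α → ℝ} {c : ℝ} {cx : V t α → ℝ}
    (hrep : ∀ I : J t α,
      f I = c + ∑ x ∈ Finset.univ.filter (fun x : V t α => Elem t α x), cx x * Tg t α x I) :
    L f = ∑ x ∈ Finset.univ.filter (fun x : V t α => Elem t α x), cx x * L (Tg t α x) := by
  have : f = c • (fun _ => (1 : ℝ)) +
      ∑ x ∈ Finset.univ.filter (fun x : V t α => Elem t α x), cx x • Tg t α x := by
    funext I
    rw [hrep I]
    simp [Finset.sum_apply]
  rw [this, map_add, map_smul, hL, map_sum]
  simp

theorem part1 (t : ℕ) (α : ℕ → ℕ) (hF : IsFence t α)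
    (f : J t α → ℝ) (hf : f ∈ chiSpan t α ∨ f ∈ chiHatSpan t α)
    (c : ℝ) (cx : V t α → ℝ)
    (hrep : ∀ I : J t α,
      f I = c + ∑ x ∈ Finset.univ.filter (fun x : V t α => Elem t α x), cx x * Tg t α x I)
    (p : V t α) (hp : IsPeakElem t α p) : cx p = 0 := by
  obtain ⟨i, hi1, hi2, hi3, hpe⟩ := hp
  obtain ⟨v, s1, s2, s3, -⟩ := shared_info hF hi1 hi2
  rw [← hpe] at v
  obtain ⟨dU, dD⟩ := s3 hi3
  obtain ⟨a, ha⟩ : ∃ a : V t α, (a : ℕ) + 1 = p := ⟨⟨p - 1, by omega⟩, by simp only []; omega⟩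
  obtain ⟨b, hb⟩ : ∃ b : V t α, (b : ℕ) = p + 1 := ⟨⟨p + 1, by omega⟩, rfl⟩
  rw [← v] at dU dD
  rw [show (p : ℕ) - 1 = a by omega] at dU
  have cap : Cov t α a p := cov_iff.2 (Or.inl ⟨by omega, by omega, dU⟩)
  have cbp : Cov t α b p := cov_iff.2 (Or.inr ⟨by omega, by omega, dD⟩)
  have ea : Elem t α a := (cov_elem cap).1
  have eb : Elem t α b := (cov_elem cbp).1
  have nab : ¬ Le t α a b := fun h => by
    rcases le_char h with ⟨h1, h2⟩ | ⟨h1, h2⟩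
    · exact not_DU_DD (h2 p (by omega) (by omega)) dD
    · omega
  have nba : ¬ Le t α b a := fun h => by
    rcases le_char h with ⟨h1, h2⟩ | ⟨h1, h2⟩
    · omega
    · exact not_DU_DD dU (h2 a (by omega) (by omega))
  have anti : ∀ x ∈ ({a, b} : Set (V t α)), ∀ y ∈ ({a, b} : Set (V t α)), Le t α x y → x = y := by
    rintro x (rfl | rfl) y (rfl | rfl) h
    · rfl
    · exact (nab h).elim
    · exact (nba h).elim
    · rfl
  have elB : ∀ x ∈ ({a, b} : Set (V t α)), Elem t α x := by
    rintro x (rfl | rfl)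
    · exact ea
    · exact eb
  let I (B : Set (V t α)) (hB : B ⊆ {a, b}) : J t α :=
    ⟨_, ideal_aux {a, b} B (fun x hx => elB x (hB hx)) hB anti⟩
  have sa : ({a} : Set (V t α)) ⊆ {a, b} := by simp
  have sb : ({b} : Set (V t α)) ⊆ {a, b} := by simp
  have s0 : (∅ : Set (V t α)) ⊆ {a, b} := by simp
  have mem : ∀ B hB x, x ∈ (I B hB).1 ↔ (Elem t α x ∧ ∀ y ∈ ({a, b} : Set (V t α)), ¬ Le t α y x) ∨ x ∈ B :=
    fun B hB x => Iff.rfl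
  have near : ∀ B hB B' hB' (x : V t α), (∀ y : V t α, (y : ℕ) ≤ x + 1 → (x : ℕ) ≤ y + 1 → (y ∈ B ↔ y ∈ B')) →
      Near (I B hB) (I B' hB') x := by
    intro B hB B' hB' x h y h1 h2
    rw [mem B hB, mem B' hB', h y h1 h2]
  let L : (J t α → ℝ) →ₗ[ℝ] ℝ := ev (I _ subset_rfl) - ev (I _ sa)
    - ev (I _ sb) + ev (I _ s0)
  have Ldef : ∀ g, L g = g (I _ subset_rfl) - g (I _ sa) - g (I _ sb) + g (I _ s0) := fun g => rfl
  have kill : ∀ g : J t α → ℝ, ∀ x : V t α, x ≠ p →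
      (∀ I I' : J t α, Near I I' x → g I = g I') → L g = 0 := by
    intro g x hx hg
    rw [Ldef]
    have hx' : (x : ℕ) ≠ p := fun h => hx (Fin.ext h)
    by_cases hxa : (x : ℕ) ≤ p
    · -- far from b
      have hbne : ∀ y : V t α, (y : ℕ) ≤ x + 1 → y ≠ b := by
        rintro y hy rfl; omega
      rw [hg _ _ (near {a, b} subset_rfl {a} sa x fun y h1 h2 => by
        simp [hbne y h1]), hg _ _ (near {b} sb ∅ s0 x fun y h1 h2 => by
        simp [hbne y h1])]
      ring
    · have hane : ∀ y : V t α, (x : ℕ) ≤ y + 1 → y ≠ a := by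
        rintro y hy rfl; omega
      rw [hg _ _ (near {a, b} subset_rfl {b} sb x fun y h1 h2 => by
        simp [hane y h2]), hg _ _ (near {a} sa ∅ s0 x fun y h1 h2 => by
        simp [hane y h2])]
      ring
  have pn : ∀ B hB, p ∉ (I B hB).1 := by
    rintro B hB (h | h)
    · exact h.2 a (by simp) (Relation.ReflTransGen.single cap)
    · rcases hB h with h | h
      · rw [h] at ha; omega
      · have : p = b := h
        rw [this] at hb; omega
  have Lf : L f = 0 := by
    rcases hf with hf | hf
    · refine span_kill L ?_ hf
      rintro g ⟨x, hx, rfl⟩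
      by_cases hxp : x = p
      · subst hxp
        have : ∀ B hB, chi t α x (I B hB) = 0 := fun B hB =>
          if_neg fun h => pn B hB h.1
        rw [Ldef]
        simp only [this]; ring
      · exact kill _ x hxp fun I I' h => near_chi h
    · refine span_kill L ?_ hf
      rintro g ⟨x, hx, rfl⟩
      by_cases hxp : x = p
      · subst hxp
        have : ∀ B hB, chiHat t α x (I B hB) = 0 := fun B hB => if_neg (pn B hB)
        rw [Ldef]
        simp only [this]; ring
      · exact kill _ x hxp fun I I' h => near_chiHat h
  have LT : L (Tg t α p) = 1 := by
    have hmax : ∀ B hB, ¬ MaxIn t α (I B hB).1 p := fun B hB h => pn B hB h.1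
    have hab : a ≠ b := by rintro rfl; omega
    have na : ∀ B hB, a ∉ B → ¬ MinOut t α (I B hB).1 p := by
      intro B hB haB h
      rcases ((minOut_iff _ _).1 h).2.2 a cap with h | h
      · exact h.2 a (by simp) Relation.ReflTransGen.refl
      · exact haB h
    have nb : ∀ B hB, b ∉ B → ¬ MinOut t α (I B hB).1 p := by
      intro B hB haB h
      rcases ((minOut_iff _ _).1 h).2.2 b cbp with h | h
      · exact h.2 b (by simp) Relation.ReflTransGen.refl
      · exact haB h
    have y1 : MinOut t α (I {a, b} (subset_refl _)).1 p := by
      refine (minOut_iff (I {a, b} (subset_refl _)) p).2 ⟨(cov_elem cap).2, pn _ (subset_refl _), fun q hq => Or.inr ?_⟩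
      rcases cov_near hq with h | h
      · left; exact Fin.ext (by omega)
      · right; exact Fin.ext (by omega)
    rw [Ldef]
    have n1 := nb {a} sa (by simp [hab.symm])
    have n2 := na {b} sb (by simp [hab])
    have n3 := na ∅ s0 (by simp)
    simp only [Tg, if_pos y1, if_neg n1, if_neg n2, if_neg n3, if_neg (hmax _ sa), if_neg (hmax _ sb), if_neg (hmax _ s0)]
    norm_num
  have L1 : L (fun _ => 1) = 0 := by rw [Ldef]; norm_num
  have := rep_apply L L1 hrep
  rw [Lf, Finset.sum_eq_single p, LT] at this
  · linarith
  · intro x _ hx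
    rw [kill _ x hx fun I I' h => near_Tg h, mul_zero]
  · intro h
    exact (h (by simp [(cov_elem cap).2])).elim

theorem max_principle (n : ℕ) (b : ℕ → ℝ) (P : ℕ → Prop) (h0 : ∀ j, ¬ P j → b j = 0)
    (hP : ∀ j, P j → 1 ≤ j ∧ j ≤ n) (h : ∀ j, P j → b (j - 1) + b (j + 1) = 2 * b j) :
    ∀ j, b j ≤ 0 := by
  by_contra hcon
  push Not at hcon
  obtain ⟨j0, hj0⟩ := hcon
  obtain ⟨k, hk, hmax⟩ := Finset.exists_max_image (Finset.range (n + 1)) b ⟨0, by simp⟩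
  have hall : ∀ j, 0 < b j → j < n + 1 := fun j hj => by
    by_contra hh
    have := h0 j fun hp => by have := hP j hp; omega
    linarith
  have hkpos : 0 < b k := lt_of_lt_of_le hj0 (hmax j0 (by simpa using hall j0 hj0))
  have hle : ∀ j, b j ≤ b k := fun j => by
    by_cases hj : j < n + 1
    · exact hmax j (by simpa using hj)
    · by_contra hh
      exact hj (hall j (by linarith))
  have all : ∀ d, d ≤ k → b (k - d) = b k := by
    intro d
    induction d with
    | zero => simp
    | succ d ih =>
      intro hd
      have e := ih (by omega)
      have pd : P (k - d) := by
        by_contra hp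
        have := h0 _ hp
        linarith
      have := h _ pd
      have h1 := hle (k - d - 1)
      have h2 := hle (k - d + 1)
      rw [show k - (d + 1) = k - d - 1 by omega]
      linarith
  have := all k le_rfl
  rw [Nat.sub_self, h0 0 fun hp => by have := hP 0 hp; omega] at this
  linarith

/-- the local equation at an unshared element -/
theorem part2_local (t : ℕ) (α : ℕ → ℕ) (hF : IsFence t α)
    (f : J t α → ℝ) (c : ℝ) (cx : V t α → ℝ)
    (hrep : ∀ I : J t α,
      f I = c + ∑ x ∈ Finset.univ.filter (fun x : V t α => Elem t α x), cx x * Tg t α x I)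
    (hpk : ∀ p : V t α, IsPeakElem t α p → cx p = 0)
    (hf : f ∈ chiSharedSpan t α ∨ f ∈ chiHatSharedSpan t α)
    (b : ℕ → ℝ) (hb0 : ∀ j, nn t α < j → b j = 0) (hb00 : b 0 = 0)
    (hbs : ∀ x : V t α, IsSharedElem t α x → b x = 0)
    (hbu : ∀ x : V t α, Elem t α x → ¬ IsSharedElem t α x → b x = cx x)
    (u : V t α) (eu : Elem t α u) (hu : ¬ IsSharedElem t α u) :
    b (u - 1) + b (u + 1) = 2 * b u := by
  have eu' : 1 ≤ (u : ℕ) := eu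
  have anti : ∀ x ∈ ({u} : Set (V t α)), ∀ y ∈ ({u} : Set (V t α)), Le t α x y → x = y := by
    rintro x rfl y rfl _; rfl
  let I0 : J t α := ⟨_, ideal_aux {u} ∅ (by simp) (by simp) anti⟩
  let I1 : J t α := ⟨_, ideal_aux {u} {u} (by rintro x rfl; exact eu) subset_rfl anti⟩
  have mem0 : ∀ x, x ∈ I0.1 ↔ Elem t α x ∧ ¬ Le t α u x := fun x => by simp [I0]
  have mem1 : ∀ x, x ∈ I1.1 ↔ x ∈ I0.1 ∨ x = u := fun x => by simp [I0, I1]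
  have hu0 : u ∉ I0.1 := fun h => ((mem0 u).1 h).2 Relation.ReflTransGen.refl
  have hu1 : u ∈ I1.1 := (mem1 u).2 (Or.inr rfl)
  have above : ∀ x, Cov t α u x → x ∉ I0.1 ∧ x ∉ I1.1 := fun x hx => by
    have h0 : x ∉ I0.1 := fun h => ((mem0 x).1 h).2 (Relation.ReflTransGen.single hx)
    refine ⟨h0, fun h => ?_⟩
    rcases (mem1 x).1 h with h | h
    · exact h0 h
    · subst h; have := cov_near hx; omega
  have below : ∀ x, Cov t α x u → x ∈ I0.1 ∧ x ∈ I1.1 := fun x hx => by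
    have h0 : x ∈ I0.1 := (mem0 x).2 ⟨(cov_elem hx).1, fun h => by
      have := le_antisymm' h (Relation.ReflTransGen.single hx)
      subst this; have := cov_near hx; omega⟩
    exact ⟨h0, (mem1 x).2 (Or.inl h0)⟩
  let L : (J t α → ℝ) →ₗ[ℝ] ℝ := ev I1 - ev I0
  have Ldef : ∀ g, L g = g I1 - g I0 := fun g => rfl
  have near : ∀ x : V t α, ((x : ℕ) + 1 < u ∨ (u : ℕ) + 1 < x) → Near I1 I0 x := by
    intro x hx y h1 h2
    rw [mem1]
    have : y ≠ u := by rintro rfl; omega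
    simp [this]
  -- neighbours are comparable
  have comp : ∀ x : V t α, Elem t α x → ((x : ℕ) + 1 = u ∨ (u : ℕ) + 1 = x) →
      Cov t α u x ∨ Cov t α x u := by
    intro x ex hx
    have ex' : 1 ≤ (x : ℕ) := ex
    have hx2 := x.2
    have hu2 := u.2
    unfold nn at hx2 hu2
    rcases hx with hx | hx
    · rcases DU_or_DD (t := t) (α := α) (j := x) (by omega) with h | h
      · right; exact cov_iff.2 (Or.inl ⟨by omega, by omega, h⟩)
      · left; exact cov_iff.2 (Or.inr ⟨by omega, by omega, h⟩)
    · rcases DU_or_DD (t := t) (α := α) (j := u) (by omega) with h | h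
      · left; exact cov_iff.2 (Or.inl ⟨by omega, by omega, h⟩)
      · right; exact cov_iff.2 (Or.inr ⟨by omega, by omega, h⟩)
  -- shared neighbours
  have valley : ∀ i, 1 ≤ i → i + 1 ≤ t → i % 2 = 0 →
      ((sElx t α i : V t α) : ℕ) + 1 = u ∨ (u : ℕ) + 1 = (sElx t α i : V t α) →
      sElx t α i ∈ I0.1 ∧ sElx t α i ∈ I1.1 ∧ ¬ MaxIn t α I0.1 (sElx t α i) ∧
      ¬ MaxIn t α I1.1 (sElx t α i) := by
    intro i h1 h2 h3 hx
    obtain ⟨v, s1, s2, -, s4⟩ := shared_info hF h1 h2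
    obtain ⟨dD, dU⟩ := s4 h3
    rw [← v] at s1 s2 dD dU
    set x := sElx t α i
    obtain ⟨y, hy⟩ : ∃ y : V t α, (y : ℕ) + 1 = x := ⟨⟨x - 1, by omega⟩, by simp only []; omega⟩
    obtain ⟨z, hz⟩ : ∃ z : V t α, (z : ℕ) = x + 1 := ⟨⟨x + 1, by omega⟩, rfl⟩
    rw [show (x : ℕ) - 1 = y by omega] at dD
    have cy : Cov t α x y := cov_iff.2 (Or.inr ⟨by omega, by omega, dD⟩)
    have cz : Cov t α x z := cov_iff.2 (Or.inl ⟨by omega, by omega, dU⟩)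
    have fin : ∀ d, Cov t α x u → Cov t α x d → ¬ Le t α u d →
        x ∈ I0.1 ∧ x ∈ I1.1 ∧ ¬ MaxIn t α I0.1 x ∧ ¬ MaxIn t α I1.1 x := by
      intro d hxu hxd hud
      have hd : d ∈ I0.1 := (mem0 d).2 ⟨(cov_elem hxd).2, hud⟩
      refine ⟨(below x hxu).1, (below x hxu).2, fun h => ?_, fun h => ?_⟩
      · exact ((maxIn_iff _ _).1 h).2 d hxd hd
      · exact ((maxIn_iff _ _).1 h).2 d hxd ((mem1 d).2 (Or.inl hd))
    rcases hx with hx | hx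
    · have : u = z := Fin.ext (by omega)
      subst this
      refine fin y cz cy fun h => ?_
      rcases le_char h with ⟨k1, k2⟩ | ⟨k1, k2⟩
      · omega
      · exact not_DU_DD dU (k2 x (by omega) (by omega))
    · have : u = y := Fin.ext (by omega)
      subst this
      refine fin z cy cz fun h => ?_
      rcases le_char h with ⟨k1, k2⟩ | ⟨k1, k2⟩
      · exact not_DU_DD (k2 u (by omega) (by omega)) dD
      · omega
  have peak : ∀ i, 1 ≤ i → i + 1 ≤ t → i % 2 = 1 →
      ((sElx t α i : V t α) : ℕ) + 1 = u ∨ (u : ℕ) + 1 = (sElx t α i : V t α) →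
      Cov t α u (sElx t α i) := by
    intro i h1 h2 h3 hx
    obtain ⟨v, s1, s2, s3, -⟩ := shared_info hF h1 h2
    obtain ⟨dU, dD⟩ := s3 h3
    rw [← v] at s1 s2 dD dU
    rcases hx with hx | hx
    · exact cov_iff.2 (Or.inr ⟨by omega, by omega, dD⟩)
    · rw [show ((sElx t α i : V t α) : ℕ) - 1 = u by omega] at dU
      exact cov_iff.2 (Or.inl ⟨by omega, by omega, dU⟩)
  have Lf : L f = 0 := by
    rcases hf with hf | hf
    · refine span_kill L ?_ hf
      rintro g ⟨i, h1, h2, rfl⟩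
      rw [Ldef]
      have hne : ((sElx t α i : V t α) : ℕ) ≠ u := fun h => hu ⟨i, h1, h2, (Fin.ext h).symm⟩
      by_cases hx : ((sElx t α i : V t α) : ℕ) + 1 = u ∨ (u : ℕ) + 1 = (sElx t α i : V t α)
      · rcases Nat.mod_two_eq_zero_or_one i with h3 | h3
        · obtain ⟨-, -, k1, k2⟩ := valley i h1 h2 h3 hx
          simp [chi, k1, k2]
        · have k := above _ (peak i h1 h2 h3 hx)
          have k1 : ¬ MaxIn t α I0.1 (sElx t α i) := fun h => k.1 h.1
          have k2 : ¬ MaxIn t α I1.1 (sElx t α i) := fun h => k.2 h.1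
          simp [chi, k1, k2]
      · rw [near_chi (near _ (by omega)), sub_self]
    · refine span_kill L ?_ hf
      rintro g ⟨i, h1, h2, rfl⟩
      rw [Ldef]
      have hne : sElx t α i ≠ u := fun h => hu ⟨i, h1, h2, h.symm⟩
      have hmm : sElx t α i ∈ I1.1 ↔ sElx t α i ∈ I0.1 := by rw [mem1]; simp only [hne, or_false]
      simp only [chiHat, hmm]
      split_ifs <;> simp
  have L1 : L (fun _ => 1) = 0 := by rw [Ldef]; norm_num
  have key := rep_apply L L1 hrep
  let G : ℕ → ℝ := fun j => (if j = u then -2 * b u else 0) + (if j = u + 1 then b (u + 1) else 0)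
    + (if j = u - 1 then b (u - 1) else 0)
  have term : ∀ x : V t α, Elem t α x → cx x * L (Tg t α x) = G x := by
    intro x ex
    have ex' : 1 ≤ (x : ℕ) := ex
    rw [Ldef]
    by_cases hxu : x = u
    · subst hxu
      have h0 : MinOut t α I0.1 x := (minOut_iff _ _).2 ⟨ex, hu0, fun q hq => (below q hq).1⟩
      have h1 : MaxIn t α I1.1 x := (maxIn_iff _ _).2 ⟨hu1, fun q hq => (above q hq).2⟩
      have h2 : ¬ MinOut t α I1.1 x := fun h => h.2.1 hu1
      have e1 : (x : ℕ) ≠ x - 1 := by omega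
      simp only [Tg, if_pos h0, if_pos h1, if_neg h2, G, hbu x ex hu, if_neg e1]
      simp
      ring
    have hxu' : (x : ℕ) ≠ u := fun h => hxu (Fin.ext h)
    by_cases hx : (x : ℕ) + 1 = u ∨ (u : ℕ) + 1 = x
    · have hG : G x = b x := by
        rcases hx with hx | hx
        · have a1 : (x : ℕ) ≠ u + 1 := by omega
          have a2 : (x : ℕ) = u - 1 := by omega
          simp only [G, if_neg hxu', if_neg a1, if_pos a2, zero_add]; rw [a2]
        · have a1 : (x : ℕ) ≠ u - 1 := by omega
          have a2 : (x : ℕ) = u + 1 := by omega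
          simp only [G, if_neg hxu', if_neg a1, if_pos a2, zero_add, add_zero]; rw [a2]
      rw [hG]
      by_cases hs : IsSharedElem t α x
      · rw [hbs x hs]
        obtain ⟨i, h1, h2, rfl⟩ := hs
        rcases Nat.mod_two_eq_zero_or_one i with h3 | h3
        · obtain ⟨m0, m1, k1, k2⟩ := valley i h1 h2 h3 hx
          have k3 : ¬ MinOut t α I0.1 (sElx t α i) := fun h => h.2.1 m0
          have k4 : ¬ MinOut t α I1.1 (sElx t α i) := fun h => h.2.1 m1
          simp [Tg, k1, k2, k3, k4]
        · rw [hpk _ ⟨i, h1, h2, h3, rfl⟩, zero_mul]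
      · rw [hbu x ex hs]
        rcases comp x ex hx with hc | hc
        · obtain ⟨a0, a1⟩ := above x hc
          have k1 : ¬ MaxIn t α I0.1 x := fun h => a0 h.1
          have k2 : ¬ MinOut t α I0.1 x := fun h => hu0 (((minOut_iff _ _).1 h).2.2 u hc)
          have k3 : MinOut t α I1.1 x := by
            refine (minOut_iff _ _).2 ⟨ex, a1, fun q hq => ?_⟩
            by_cases hqu : q = u
            · rw [hqu]; exact hu1
            · exfalso
              have hqu' : (q : ℕ) ≠ u := fun h => hqu (Fin.ext h)
              rcases cov_iff.1 hq with ⟨p1, p2, p3⟩ | ⟨p1, p2, p3⟩ <;>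
                rcases cov_iff.1 hc with ⟨q1, q2, q3⟩ | ⟨q1, q2, q3⟩
              · omega
              · exact hs (seg_change p1 (Or.inl ⟨p3, q3⟩))
              · exact hs (seg_change q1 (Or.inl ⟨q3, p3⟩))
              · omega
          simp [Tg, k1, k2, k3]
        · obtain ⟨a0, a1⟩ := below x hc
          have k1 : ¬ MinOut t α I0.1 x := fun h => h.2.1 a0
          have k2 : ¬ MinOut t α I1.1 x := fun h => h.2.1 a1
          have k3 : ¬ MaxIn t α I1.1 x := fun h => ((maxIn_iff _ _).1 h).2 u hc hu1
          have k4 : MaxIn t α I0.1 x := by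
            refine (maxIn_iff _ _).2 ⟨a0, fun q hq => ?_⟩
            by_cases hqu : q = u
            · rw [hqu]; exact hu0
            · exfalso
              have hqu' : (q : ℕ) ≠ u := fun h => hqu (Fin.ext h)
              rcases cov_iff.1 hq with ⟨p1, p2, p3⟩ | ⟨p1, p2, p3⟩ <;>
                rcases cov_iff.1 hc with ⟨q1, q2, q3⟩ | ⟨q1, q2, q3⟩
              · omega
              · exact hs (seg_change q1 (Or.inr ⟨q3, p3⟩))
              · exact hs (seg_change p1 (Or.inr ⟨p3, q3⟩))
              · omega
          simp [Tg, k1, k2, k3, k4]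
    · rw [near_Tg (near x (by omega)), sub_self, mul_zero]
      have a1 : (x : ℕ) ≠ u - 1 := by omega
      have a2 : (x : ℕ) ≠ u + 1 := by omega
      simp only [G, if_neg hxu', if_neg a1, if_neg a2, add_zero]
  rw [Lf, Finset.sum_congr rfl fun x hx => term x (Finset.mem_filter.1 hx).2,
    Finset.sum_filter_of_ne, Fin.sum_univ_eq_sum_range G] at key
  · simp only [G, Finset.sum_add_distrib, Finset.sum_ite_eq', Finset.mem_range] at key
    rw [if_pos u.2, if_pos (show (u : ℕ) - 1 < nn t α + 1 by omega)] at key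
    by_cases h : (u : ℕ) + 1 < nn t α + 1
    · rw [if_pos h] at key; linarith
    · rw [if_neg h] at key
      rw [hb0 (u + 1) (by omega)]
      linarith
  · intro x _ hx
    by_contra hne
    have hx0 : (x : ℕ) = 0 := by
      unfold Elem at hne; omega
    apply hx
    simp only [G, hx0]
    rw [if_neg (by omega), if_neg (by omega)]
    split_ifs with h
    · rw [← h, hb00]; simp
    · simp

end helpers

/-- Lemma `peak 0 coeffs`.
If `f` is in the span of the antichain indicators or of the order-ideal indicators, and
`f = c + Σ_{x ∈ F} c_x T_x`, then `c_p = 0` for every peak `p`. If moreover `f` is in the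
span of the indicators of the shared elements, then also `c_u = 0` for every unshared `u`. -/
theorem statement2 (t : ℕ) (α : ℕ → ℕ) (hF : IsFence t α)
    (f : J t α → ℝ) (hf : f ∈ chiSpan t α ∨ f ∈ chiHatSpan t α)
    (c : ℝ) (cx : V t α → ℝ)
    (hrep : ∀ I : J t α,
      f I = c + ∑ x ∈ Finset.univ.filter (fun x : V t α => Elem t α x), cx x * Tg t α x I) :
    (∀ p : V t α, IsPeakElem t α p → cx p = 0)
    ∧ ((f ∈ chiSharedSpan t α ∨ f ∈ chiHatSharedSpan t α) →
        ∀ u : V t α, Elem t α u → ¬ IsSharedElem t α u → cx u = 0) := by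
  have hpk := part1 t α hF f hf c cx hrep
  refine ⟨hpk, fun hsh => ?_⟩
  let P : ℕ → Prop := fun j => ∃ h : j < nn t α + 1, 1 ≤ j ∧ ¬ IsSharedElem t α ⟨j, h⟩
  let b : ℕ → ℝ := fun j => if h : P j then cx ⟨j, h.1⟩ else 0
  have hb0 : ∀ j, ¬ P j → b j = 0 := fun j h => dif_neg h
  have hbu : ∀ x : V t α, Elem t α x → ¬ IsSharedElem t α x → b x = cx x :=
    fun x ex hx => dif_pos (show P x from ⟨x.2, ex, hx⟩)
  have loc : ∀ j, P j → b (j - 1) + b (j + 1) = 2 * b j := by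
    rintro j ⟨hj, h1, h2⟩
    exact part2_local t α hF f c cx hrep hpk hsh b
      (fun j hj => hb0 j fun h => by have := h.1; omega)
      (hb0 0 fun h => by have := h.2.1; omega)
      (fun x hx => hb0 x fun h => h.2.2 hx) hbu ⟨j, hj⟩ h1 h2
  have hP : ∀ j, P j → 1 ≤ j ∧ j ≤ nn t α := fun j h => ⟨h.2.1, by have := h.1; omega⟩
  intro u eu hu
  have k1 := max_principle (nn t α) b P hb0 hP loc u
  have k2 := max_principle (nn t α) (fun j => - b j) P (fun j h => by simp [hb0 j h]) hP
    (fun j h => by have := loc j h; linarith) u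
  rw [← hbu u eu hu]
  linarith


end Fence
end
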